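/- (Theorem: the equilibrium manifold of a two-consumer exchange economy has non-positive sectional curvature, coordinate form.) For every index i with 1 ≤ i ≤ L−1 and every (t,α) ∈ ℝ × ℝ^{L−1}, the sectional curvature of the coordinate plane spanned by X_0 and X_i, namely K(X_0,X_i)(t,α) = ( Σ_{s=0}^{L−1} R^s_{0i0}(t,α) g_{si}(t,α) ) / ( g_{00}(t,α) g_{ii}(t,α) − g_{0i}(t,α)² ), is well defined (the denominator is strictly positive) and satisfies K(X_0,X_i)(t,α) ≤ 0. -/

import Mathlib

/-!
Formalization of results from "A geometric approach to equilibrium selection":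
the metric, Christoffel symbols and curvature of the equilibrium manifold of a
two-consumer exchange economy with `L` goods, parametrized by
`Φ(t,α) = (p_1(t),…,p_{L−1}(t), α_1,…,α_{L−1}, w(t) − Σ_m p_m(t) α_m)`.

Indices run over `Fin L`, where the index `0` corresponds to the coordinate
`x_0 = t` and an index `i ≠ 0` corresponds to the coordinate `x_i = α_i`
(the component `α 0` of `α : Fin L → ℝ` is never used, so `α` is just a copy
of `ℝ^{L−1}` together with an irrelevant extra coordinate).
-/

open Matrix BigOperators

noncomputable section

namespace EqSelection

variable {L : ℕ}

/-- `A(t,α) = w'(t) − Σ_{m=1}^{L−1} p_m'(t) α_m`. -/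
def eqA [NeZero L] (p : Fin L → ℝ → ℝ) (w : ℝ → ℝ) (t : ℝ) (α : Fin L → ℝ) : ℝ :=
  deriv w t - ∑ m ∈ Finset.univ \ {0}, deriv (p m) t * α m

/-- `A'(t,α) = w''(t) − Σ_{m=1}^{L−1} p_m''(t) α_m`. -/
def eqA' [NeZero L] (p : Fin L → ℝ → ℝ) (w : ℝ → ℝ) (t : ℝ) (α : Fin L → ℝ) : ℝ :=
  deriv (deriv w) t - ∑ m ∈ Finset.univ \ {0}, deriv (deriv (p m)) t * α m

/-- `B(t) = Σ_{m=1}^{L−1} (p_m'(t))²`. -/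
def eqB [NeZero L] (p : Fin L → ℝ → ℝ) (t : ℝ) : ℝ :=
  ∑ m ∈ Finset.univ \ {0}, (deriv (p m) t) ^ 2

/-- `N(t) = 1 + Σ_{m=1}^{L−1} (p_m(t))²`. -/
def eqN [NeZero L] (p : Fin L → ℝ → ℝ) (t : ℝ) : ℝ :=
  1 + ∑ m ∈ Finset.univ \ {0}, (p m t) ^ 2

/-- `C(t) = Σ_{m=1}^{L−1} p_m'(t) p_m''(t)`. -/
def eqC [NeZero L] (p : Fin L → ℝ → ℝ) (t : ℝ) : ℝ :=
  ∑ m ∈ Finset.univ \ {0}, deriv (p m) t * deriv (deriv (p m)) t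

/-- `P(t) = Σ_{m=1}^{L−1} p_m(t) p_m'(t)`. -/
def eqP [NeZero L] (p : Fin L → ℝ → ℝ) (t : ℝ) : ℝ :=
  ∑ m ∈ Finset.univ \ {0}, p m t * deriv (p m) t

/-- The induced metric matrix `g(t,α)`: `g_{00} = B + A²`, `g_{0i} = g_{i0} = −p_i A`,
`g_{ij} = p_i p_j + δ_{ij}` for `i, j ≠ 0`. -/
def gMat [NeZero L] (p : Fin L → ℝ → ℝ) (w : ℝ → ℝ) (t : ℝ) (α : Fin L → ℝ) :
    Matrix (Fin L) (Fin L) ℝ :=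
  Matrix.of fun i j =>
    if i = 0 then
      if j = 0 then eqB p t + (eqA p w t α) ^ 2 else -(p j t) * eqA p w t α
    else
      if j = 0 then -(p i t) * eqA p w t α
      else p i t * p j t + (if i = j then 1 else 0)

/-- Partial derivative with respect to the coordinate `x_k`, where `x_0 = t`
and `x_i = α_i` for `i ≠ 0`. -/
def pder [NeZero L] (k : Fin L) (f : ℝ → (Fin L → ℝ) → ℝ) (t : ℝ) (α : Fin L → ℝ) : ℝ :=
  if k = 0 then deriv (fun s => f s α) t
  else deriv (fun s => f t (Function.update α k s)) (α k)

/-- Christoffel symbol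
`Γ^k_{ij} = (1/2) Σ_{h=0}^{L−1} g^{hk} (∂g_{jh}/∂x_i + ∂g_{hi}/∂x_j − ∂g_{ij}/∂x_h)`,
written `christoffel p w i j k`.  (Here `g^{hk}` denotes the entries of the inverse
matrix of `g`, i.e. of `(gMat p w t α)⁻¹`.) -/
def christoffel [NeZero L] (p : Fin L → ℝ → ℝ) (w : ℝ → ℝ) (i j k : Fin L)
    (t : ℝ) (α : Fin L → ℝ) : ℝ :=
  (1 / 2) * ∑ h : Fin L,
    (gMat p w t α)⁻¹ h k *
      (pder i (fun t' α' => gMat p w t' α' j h) t α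
        + pder j (fun t' α' => gMat p w t' α' h i) t α
        - pder h (fun t' α' => gMat p w t' α' i j) t α)

/-- Curvature coefficient
`R^s_{ijk} = Σ_{m} Γ^m_{ik} Γ^s_{jm} − Σ_{m} Γ^m_{jk} Γ^s_{im} + ∂Γ^s_{ik}/∂x_j − ∂Γ^s_{jk}/∂x_i`,
written `curvR p w i j k s`. -/
def curvR [NeZero L] (p : Fin L → ℝ → ℝ) (w : ℝ → ℝ) (i j k s : Fin L)
    (t : ℝ) (α : Fin L → ℝ) : ℝ :=
  (∑ m : Fin L, christoffel p w i k m t α * christoffel p w j m s t α)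
    - (∑ m : Fin L, christoffel p w j k m t α * christoffel p w i m s t α)
    + pder j (christoffel p w i k s) t α - pder i (christoffel p w j k s) t α

/-- The coordinate tangent vectors `Φ_i(t,α) ∈ ℝ^{2L−1}` of the parametrization
`Φ(t,α) = (p_1(t),…,p_{L−1}(t), α_1,…,α_{L−1}, w(t) − Σ_m p_m(t) α_m)`:
`Φ_0 = (p_1',…,p_{L−1}', 0,…,0, A)`, and for `i ≠ 0` the vector `Φ_i` has entry `1`
in position `(L−1)+i` (1-indexed), entry `−p_i` in the last position and `0` elsewhere. -/
def PhiVec [NeZero L] (p : Fin L → ℝ → ℝ) (w : ℝ → ℝ) (i : Fin L)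
    (t : ℝ) (α : Fin L → ℝ) : Fin (2 * L - 1) → ℝ :=
  fun j =>
    if i = 0 then
      if h : (j : ℕ) < L - 1 then deriv (p ⟨(j : ℕ) + 1, by omega⟩) t
      else if (j : ℕ) = 2 * L - 2 then eqA p w t α else 0
    else
      if (j : ℕ) + 1 = (L - 1) + (i : ℕ) then 1
      else if (j : ℕ) = 2 * L - 2 then -(p i t) else 0

/-- The matrix `M(t,α)` of Statement 2: `M_{00} = N`, `M_{0i} = M_{i0} = p_i A`,
`M_{ii} = (N − p_i²) B + A²`, `M_{ij} = −p_i p_j B` for `i ≠ j`, `i, j ≠ 0`. -/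
def invNumer [NeZero L] (p : Fin L → ℝ → ℝ) (w : ℝ → ℝ) (t : ℝ) (α : Fin L → ℝ) :
    Matrix (Fin L) (Fin L) ℝ :=
  Matrix.of fun i j =>
    if i = 0 then
      if j = 0 then eqN p t else p j t * eqA p w t α
    else
      if j = 0 then p i t * eqA p w t α
      else if i = j then (eqN p t - (p i t) ^ 2) * eqB p t + (eqA p w t α) ^ 2
      else -(p i t * p j t * eqB p t)

/-- The coordinate line through `(t, α)` in direction `x_k`, parametrized by the value of `x_k`. -/
def coordLine [NeZero L] (k : Fin L) (t : ℝ) (α : Fin L → ℝ) (s : ℝ) : ℝ × (Fin L → ℝ) :=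
  if k = 0 then (s, α) else (t, Function.update α k s)

/-- The `k`-th coordinate of the point `(t, α)`. -/
def coordVal [NeZero L] (k : Fin L) (t : ℝ) (α : Fin L → ℝ) : ℝ :=
  if k = 0 then t else α k

/-- `f` has partial derivative `f'` with respect to `x_k` at `(t, α)`. -/
def HasPder [NeZero L] (k : Fin L) (f : ℝ → (Fin L → ℝ) → ℝ) (f' : ℝ) (t : ℝ)
    (α : Fin L → ℝ) : Prop :=
  HasDerivAt (fun s => f (coordLine k t α s).1 (coordLine k t α s).2) f' (coordVal k t α)

section Pder

variable [NeZero L] {k : Fin L} {f g : ℝ → (Fin L → ℝ) → ℝ} {f' g' t : ℝ} {α : Fin L → ℝ}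

lemma coordLine_coordVal : coordLine k t α (coordVal k t α) = (t, α) := by
  unfold coordLine coordVal
  split_ifs <;> simp

lemma pder_eq_deriv : pder k f t α =
    deriv (fun s => f (coordLine k t α s).1 (coordLine k t α s).2) (coordVal k t α) := by
  unfold pder coordLine coordVal
  split_ifs <;> rfl

lemma HasPder.pder_eq (h : HasPder k f f' t α) : pder k f t α = f' := by
  rw [pder_eq_deriv]
  exact h.deriv

lemma HasPder.unique (h : HasPder k f f' t α) (h' : HasPder k f g' t α) : f' = g' :=
  HasDerivAt.unique h h'

lemma hasPder_zero : HasPder 0 f f' t α ↔ HasDerivAt (fun s => f s α) f' t := by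
  simp [HasPder, coordLine, coordVal]

lemma hasPder_of_ne_zero (hk : k ≠ 0) :
    HasPder k f f' t α ↔ HasDerivAt (fun s => f t (Function.update α k s)) f' (α k) := by
  simp [HasPder, coordLine, coordVal, hk]

lemma hasPder_const (c : ℝ) : HasPder k (fun _ _ => c) 0 t α := hasDerivAt_const _ c

lemma HasPder.add (hf : HasPder k f f' t α) (hg : HasPder k g g' t α) :
    HasPder k (fun t α => f t α + g t α) (f' + g') t α :=
  HasDerivAt.fun_add hf hg

lemma HasPder.mul (hf : HasPder k f f' t α) (hg : HasPder k g g' t α) :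
    HasPder k (fun t α => f t α * g t α) (f' * g t α + f t α * g') t α := by
  have := HasDerivAt.fun_mul hf hg
  rwa [coordLine_coordVal] at this

lemma HasPder.div (hf : HasPder k f f' t α) (hg : HasPder k g g' t α) (h0 : g t α ≠ 0) :
    HasPder k (fun t α => f t α / g t α) ((f' * g t α - f t α * g') / g t α ^ 2) t α := by
  have := HasDerivAt.fun_div hf hg (by rwa [coordLine_coordVal])
  rwa [coordLine_coordVal] at this

lemma HasPder.sum {ι : Type*} {u : Finset ι} {F : ι → ℝ → (Fin L → ℝ) → ℝ} {F' : ι → ℝ}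
    (h : ∀ i ∈ u, HasPder k (F i) (F' i) t α) :
    HasPder k (fun t α => ∑ i ∈ u, F i t α) (∑ i ∈ u, F' i) t α :=
  HasDerivAt.fun_sum h

/-- A function of `t` only. -/
lemma hasPder_of_hasDerivAt {φ : ℝ → ℝ} {φ' : ℝ} (h : HasDerivAt φ φ' t) :
    HasPder k (fun t _ => φ t) (if k = 0 then φ' else 0) t α := by
  by_cases hk : k = 0
  · subst hk
    simpa [hasPder_zero] using h
  · simpa [hasPder_of_ne_zero hk, hk] using hasDerivAt_const (α k) (φ t)

lemma hasPder_coord {m : Fin L} (hm : m ≠ 0) :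
    HasPder k (fun _ α => α m) (if k = m then 1 else 0) t α := by
  by_cases hk : k = 0
  · subst hk
    simpa [hasPder_zero, hm.symm] using hasDerivAt_const t (α m)
  · rw [hasPder_of_ne_zero hk]
    by_cases h : k = m
    · subst h
      simpa using hasDerivAt_id' (α k)
    · simpa [h, Function.update_of_ne (Ne.symm h)] using hasDerivAt_const (α k) (α m)

end Pder

/-- The last components of the coordinate tangent vectors: `v_0 = A`, `v_i = −p_i`. -/
def lastComp [NeZero L] (p : Fin L → ℝ → ℝ) (w : ℝ → ℝ) (i : Fin L) (t : ℝ)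
    (α : Fin L → ℝ) : ℝ :=
  if i = 0 then eqA p w t α else -(p i t)

/-- The second derivatives of `w(t) − Σ_m p_m(t) α_m`. -/
def lastHess [NeZero L] (p : Fin L → ℝ → ℝ) (w : ℝ → ℝ) (i j : Fin L) (t : ℝ)
    (α : Fin L → ℝ) : ℝ :=
  if i = 0 then if j = 0 then eqA' p w t α else -(deriv (p j) t)
  else if j = 0 then -(deriv (p i) t) else 0

/-- The determinant `N B + A²` of the metric. -/
def eqDet [NeZero L] (p : Fin L → ℝ → ℝ) (w : ℝ → ℝ) (t : ℝ) (α : Fin L → ℝ) : ℝ :=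
  eqN p t * eqB p t + eqA p w t α ^ 2

/-- `D • g⁻¹ v`, where `D = N B + A²` and `v = lastComp`. -/
def raisedLast [NeZero L] (p : Fin L → ℝ → ℝ) (w : ℝ → ℝ) (i : Fin L) (t : ℝ)
    (α : Fin L → ℝ) : ℝ :=
  if i = 0 then eqA p w t α else -(p i t) * eqB p t

section Algebra

variable [NeZero L] (p : Fin L → ℝ → ℝ) (w : ℝ → ℝ) (t : ℝ) (α : Fin L → ℝ)

lemma sum_eq_zero_add (f : Fin L → ℝ) : ∑ i, f i = f 0 + ∑ i ∈ Finset.univ \ {0}, f i := by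
  rw [← Finset.sum_sdiff (Finset.subset_univ {(0 : Fin L)})]
  simp [add_comm]

lemma eqB_nonneg : 0 ≤ eqB p t := Finset.sum_nonneg fun _ _ => sq_nonneg _

lemma one_le_eqN : 1 ≤ eqN p t :=
  le_add_of_nonneg_right (Finset.sum_nonneg fun _ _ => sq_nonneg _)

lemma eqB_pos_or_eqA_ne_zero (hreg : 0 < eqB p t ∨ deriv w t ≠ 0) :
    0 < eqB p t ∨ eqA p w t α ≠ 0 := by
  rcases (eqB_nonneg p t).lt_or_eq with hB | hB
  · exact Or.inl hB
  · refine Or.inr ?_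
    have h0 : ∀ m ∈ Finset.univ \ {0}, deriv (p m) t ^ 2 = 0 :=
      (Finset.sum_eq_zero_iff_of_nonneg fun _ _ => sq_nonneg _).1 hB.symm
    have hA : eqA p w t α = deriv w t := by
      rw [eqA, Finset.sum_eq_zero, sub_zero]
      intro m hm
      rw [pow_eq_zero_iff two_ne_zero |>.1 (h0 m hm), zero_mul]
    rw [hA]
    exact hreg.resolve_left hB.symm.not_gt

lemma mul_eqB_add_sq_pos {c : ℝ} (hc : 0 < c) (hreg : 0 < eqB p t ∨ deriv w t ≠ 0) :
    0 < c * eqB p t + eqA p w t α ^ 2 := by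
  rcases eqB_pos_or_eqA_ne_zero p w t α hreg with h | h
  · positivity
  · have := eqB_nonneg p t
    positivity

lemma eqDet_pos (hreg : 0 < eqB p t ∨ deriv w t ≠ 0) : 0 < eqDet p w t α :=
  mul_eqB_add_sq_pos p w t α (zero_lt_one.trans_le (one_le_eqN p t)) hreg

lemma gMat_apply (i j : Fin L) : gMat p w t α i j =
    (if i = j then if i = 0 then eqB p t else 1 else 0)
      + lastComp p w i t α * lastComp p w j t α := by
  by_cases hi : i = 0 <;> by_cases hj : j = 0 <;>
    simp [gMat, lastComp, hi, hj, Ne.symm] <;> ring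

lemma lastHess_symm (i j : Fin L) : lastHess p w i j t α = lastHess p w j i t α := by
  unfold lastHess
  split_ifs <;> rfl

lemma sum_sq_eq : ∑ m ∈ Finset.univ \ {0}, p m t * p m t = eqN p t - 1 := by
  simp [eqN, sq]

lemma invNumer_apply {i j : Fin L} (hi : i ≠ 0) (hj : j ≠ 0) : invNumer p w t α i j =
    (if i = j then eqDet p w t α else 0) - p i t * p j t * eqB p t := by
  by_cases h : i = j
  · subst h
    simp [invNumer, hi, eqDet]
    ring
  · simp [invNumer, hi, hj, h]

lemma sum_lastComp_mul_invNumer (j : Fin L) :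
    ∑ h, lastComp p w h t α * invNumer p w t α h j = raisedLast p w j t α := by
  rw [sum_eq_zero_add]
  by_cases hj : j = 0
  · subst hj
    have : ∑ h ∈ Finset.univ \ {0}, lastComp p w h t α * invNumer p w t α h 0
        = ∑ h ∈ Finset.univ \ {0}, -(eqA p w t α) * (p h t * p h t) :=
      Finset.sum_congr rfl fun h hh => by
        have hh : h ≠ 0 := by simpa using hh
        simp [lastComp, invNumer, hh]
        ring
    rw [this, ← Finset.mul_sum, sum_sq_eq]
    simp [lastComp, invNumer, raisedLast]
    ring
  · have : ∑ h ∈ Finset.univ \ {0}, lastComp p w h t α * invNumer p w t α h j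
        = ∑ h ∈ Finset.univ \ {0}, ((p j t * eqB p t) * (p h t * p h t)
          - if h = j then p j t * eqDet p w t α else 0) :=
      Finset.sum_congr rfl fun h hh => by
        have hh : h ≠ 0 := by simpa using hh
        rw [invNumer_apply p w t α hh hj]
        by_cases e : h = j
        · subst e
          simp [lastComp, hh]
          ring
        · simp [lastComp, hh, e]
          ring
    rw [this, Finset.sum_sub_distrib, ← Finset.mul_sum, sum_sq_eq, Finset.sum_ite_eq']
    simp [lastComp, invNumer, raisedLast, hj, eqDet]
    ring

lemma gMat_mul_invNumer : gMat p w t α * invNumer p w t α = eqDet p w t α • 1 := by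
  ext i j
  simp only [Matrix.mul_apply, gMat_apply, add_mul, Finset.sum_add_distrib, ite_mul, zero_mul,
    Finset.sum_ite_eq, Finset.mem_univ, if_true, mul_assoc, ← Finset.mul_sum,
    sum_lastComp_mul_invNumer, Matrix.smul_apply, Matrix.one_apply, smul_eq_mul]
  by_cases hi : i = 0
  · subst hi
    by_cases hj : j = 0
    · subst hj
      simp [invNumer, lastComp, raisedLast, eqDet]
      ring
    · simp [invNumer, lastComp, raisedLast, hj, Ne.symm hj]
      ring
  · by_cases hj : j = 0
    · subst hj
      simp [invNumer, lastComp, raisedLast, hi]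
    · rw [invNumer_apply p w t α hi hj]
      simp [lastComp, raisedLast, hi, hj]
      ring

lemma gMat_inv (hD : eqDet p w t α ≠ 0) :
    (gMat p w t α)⁻¹ = (eqDet p w t α)⁻¹ • invNumer p w t α := by
  apply Matrix.inv_eq_right_inv
  rw [Matrix.mul_smul, gMat_mul_invNumer, smul_smul, inv_mul_cancel₀ hD, one_smul]

lemma gMat_mul_inv (hD : eqDet p w t α ≠ 0) : gMat p w t α * (gMat p w t α)⁻¹ = 1 := by
  rw [gMat_inv p w t α hD, Matrix.mul_smul, gMat_mul_invNumer, smul_smul, inv_mul_cancel₀ hD,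
    one_smul]

end Algebra

section Calculus

variable [NeZero L] {p : Fin L → ℝ → ℝ} {w : ℝ → ℝ}

lemma hasPder_price (hp : ∀ i, ContDiff ℝ (⊤ : ℕ∞) (p i)) (i k : Fin L) (t : ℝ)
    (α : Fin L → ℝ) :
    HasPder k (fun t _ => p i t) (if k = 0 then deriv (p i) t else 0) t α :=
  hasPder_of_hasDerivAt (((hp i).differentiable (by simp)) t).hasDerivAt

lemma _root_.ContDiff.hasDerivAt_deriv_of_top {φ : ℝ → ℝ} (h : ContDiff ℝ (⊤ : ℕ∞) φ) (t : ℝ) :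
    HasDerivAt (deriv φ) (deriv (deriv φ) t) t :=
  ((contDiff_infty_iff_deriv.1 h).2.differentiable (by simp) t).hasDerivAt

lemma hasPder_eqB (hp : ∀ i, ContDiff ℝ (⊤ : ℕ∞) (p i)) (k : Fin L) (t : ℝ) (α : Fin L → ℝ) :
    HasPder k (fun t _ => eqB p t) (if k = 0 then 2 * eqC p t else 0) t α := by
  refine hasPder_of_hasDerivAt (φ := eqB p) ?_
  unfold eqC
  rw [Finset.mul_sum]
  refine HasDerivAt.fun_sum fun m _ => ?_
  refine (((hp m).hasDerivAt_deriv_of_top t).fun_pow 2).congr_deriv ?_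
  simp
  ring

lemma hasPder_eqA (hp : ∀ i, ContDiff ℝ (⊤ : ℕ∞) (p i)) (hw : ContDiff ℝ (⊤ : ℕ∞) w)
    (k : Fin L) (t : ℝ) (α : Fin L → ℝ) :
    HasPder k (eqA p w) (lastHess p w k 0 t α) t α := by
  have hs := HasPder.sum (k := k) (t := t) (α := α) (u := Finset.univ \ {0})
    (F := fun m t α => deriv (p m) t * α m) fun m hm =>
      (hasPder_of_hasDerivAt ((hp m).hasDerivAt_deriv_of_top t)).mul
        (hasPder_coord (by simpa using hm))
  refine (HasDerivAt.fun_sub (hasPder_of_hasDerivAt (hw.hasDerivAt_deriv_of_top t)) hs).congr_deriv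
    ?_
  by_cases hk : k = 0
  · subst hk
    simp only [if_true, lastHess, eqA']
    congr 1
    refine Finset.sum_congr rfl fun m hm => ?_
    have hm : m ≠ 0 := by simpa using hm
    simp [hm.symm]
  · simp [hk, lastHess]

lemma hasPder_lastComp (hp : ∀ i, ContDiff ℝ (⊤ : ℕ∞) (p i)) (hw : ContDiff ℝ (⊤ : ℕ∞) w)
    (k i : Fin L) (t : ℝ) (α : Fin L → ℝ) :
    HasPder k (lastComp p w i) (lastHess p w k i t α) t α := by
  by_cases hi : i = 0
  · subst hi
    simpa [HasPder, lastComp] using hasPder_eqA hp hw k t α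
  · have := (hasPder_const (k := k) (t := t) (α := α) (-1)).mul (hasPder_price hp i k t α)
    by_cases hk : k = 0 <;> simpa [HasPder, lastComp, lastHess, hi, hk] using this

lemma hasPder_gMat (hp : ∀ i, ContDiff ℝ (⊤ : ℕ∞) (p i)) (hw : ContDiff ℝ (⊤ : ℕ∞) w)
    (k i j : Fin L) (t : ℝ) (α : Fin L → ℝ) :
    HasPder k (fun t α => gMat p w t α i j)
      ((if k = 0 ∧ i = 0 ∧ j = 0 then 2 * eqC p t else 0)
        + (lastHess p w k i t α * lastComp p w j t α
          + lastComp p w i t α * lastHess p w k j t α)) t α := by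
  simp only [gMat_apply]
  refine HasPder.add ?_ ((hasPder_lastComp hp hw k i t α).mul (hasPder_lastComp hp hw k j t α))
  by_cases hi : i = 0
  · subst hi
    by_cases hj : j = 0
    · subst hj
      simpa using hasPder_eqB hp k t α
    · simpa [hj, Ne.symm hj] using hasPder_const 0
  · simpa [hi] using hasPder_const _

lemma christoffel_eq_sum (hp : ∀ i, ContDiff ℝ (⊤ : ℕ∞) (p i)) (hw : ContDiff ℝ (⊤ : ℕ∞) w)
    (i j k : Fin L) (t : ℝ) (α : Fin L → ℝ) :
    christoffel p w i j k t α = ∑ h, (gMat p w t α)⁻¹ h k *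
      (lastHess p w i j t α * lastComp p w h t α
        + if i = 0 ∧ j = 0 ∧ h = 0 then eqC p t else 0) := by
  rw [christoffel, Finset.mul_sum]
  refine Finset.sum_congr rfl fun h _ => ?_
  rw [(hasPder_gMat hp hw i j h t α).pder_eq, (hasPder_gMat hp hw j h i t α).pder_eq,
    (hasPder_gMat hp hw h i j t α).pder_eq, lastHess_symm p w t α j i, lastHess_symm p w t α h i,
    lastHess_symm p w t α h j]
  by_cases hi : i = 0 <;> by_cases hj : j = 0 <;> by_cases hh : h = 0 <;>
    simp only [hi, hj, hh, and_true, and_false, if_true, if_false] <;> ring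

/-- The Christoffel symbols in closed form. -/
lemma christoffel_eq (hp : ∀ i, ContDiff ℝ (⊤ : ℕ∞) (p i)) (hw : ContDiff ℝ (⊤ : ℕ∞) w)
    (i j k : Fin L) (t : ℝ) (α : Fin L → ℝ) (hD : eqDet p w t α ≠ 0) :
    christoffel p w i j k t α = (lastHess p w i j t α * raisedLast p w k t α
      + if i = 0 ∧ j = 0 then eqC p t * invNumer p w t α 0 k else 0) / eqDet p w t α := by
  rw [christoffel_eq_sum hp hw, gMat_inv p w t α hD, ← sum_lastComp_mul_invNumer]
  have h1 : ∀ h, ((eqDet p w t α)⁻¹ • invNumer p w t α) h k *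
      (lastHess p w i j t α * lastComp p w h t α
        + if i = 0 ∧ j = 0 ∧ h = 0 then eqC p t else 0)
      = lastHess p w i j t α * (lastComp p w h t α * invNumer p w t α h k) / eqDet p w t α
        + if h = 0 then (if i = 0 ∧ j = 0 then eqC p t * invNumer p w t α 0 k else 0)
            / eqDet p w t α else 0 := by
    intro h
    rw [Matrix.smul_apply, smul_eq_mul]
    by_cases hh : h = 0
    · subst hh
      by_cases hij : i = 0 ∧ j = 0
      · simp [hij]
        ring
      · simp [hij]
        ring
    · simp [hh]
      ring
  rw [Finset.sum_congr rfl fun h _ => h1 h, Finset.sum_add_distrib, Finset.sum_ite_eq',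
    ← Finset.sum_div, ← Finset.mul_sum, add_div]
  simp

/-- Christoffel symbols of the first kind. -/
lemma sum_christoffel_mul_gMat (hp : ∀ i, ContDiff ℝ (⊤ : ℕ∞) (p i))
    (hw : ContDiff ℝ (⊤ : ℕ∞) w) (i j l : Fin L) (t : ℝ) (α : Fin L → ℝ)
    (hD : eqDet p w t α ≠ 0) :
    ∑ s, christoffel p w i j s t α * gMat p w t α s l
      = lastHess p w i j t α * lastComp p w l t α
        + if i = 0 ∧ j = 0 ∧ l = 0 then eqC p t else 0 := by
  have key : ∀ c : Fin L → ℝ,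
      ∑ s, (∑ h, (gMat p w t α)⁻¹ h s * c h) * gMat p w t α s l = c l := by
    intro c
    have := congrArg (fun M => (c ᵥ* M) l)
      (_root_.mul_eq_one_comm.1 (gMat_mul_inv p w t α hD))
    rw [← Matrix.vecMul_vecMul, Matrix.vecMul_one] at this
    simpa [Matrix.vecMul, dotProduct, mul_comm] using this
  simp only [christoffel_eq_sum hp hw]
  exact key _

lemma hasPder_lastHess_zero_zero (hp : ∀ i, ContDiff ℝ (⊤ : ℕ∞) (p i))
    (hw : ContDiff ℝ (⊤ : ℕ∞) w) {k : Fin L} (hk : k ≠ 0) (t : ℝ) (α : Fin L → ℝ) :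
    HasPder k (lastHess p w 0 0) (-(deriv (deriv (p k)) t)) t α := by
  have h := hasPder_eqA (p := fun m => deriv (p m)) (w := deriv w)
    (fun m => (contDiff_infty_iff_deriv.1 (hp m)).2) (contDiff_infty_iff_deriv.1 hw).2 k t α
  simpa [HasPder, lastHess, hk, eqA, eqA'] using h

lemma hasPder_lastHess_right_zero (hp : ∀ i, ContDiff ℝ (⊤ : ℕ∞) (p i)) {k : Fin L} (hk : k ≠ 0)
    (t : ℝ) (α : Fin L → ℝ) :
    HasPder 0 (lastHess p w k 0) (-(deriv (deriv (p k)) t)) t α := by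
  simpa [hasPder_zero, lastHess, hk] using ((hp k).hasDerivAt_deriv_of_top t).fun_neg

lemma exists_hasPder_eqN (hp : ∀ i, ContDiff ℝ (⊤ : ℕ∞) (p i)) (k : Fin L) (t : ℝ)
    (α : Fin L → ℝ) : ∃ d, HasPder k (fun t _ => eqN p t) d t α := by
  simp only [eqN, sq]
  exact ⟨_, (hasPder_const 1).add (HasPder.sum fun m _ =>
    (hasPder_price hp m k t α).mul (hasPder_price hp m k t α))⟩

lemma exists_hasPder_eqDet (hp : ∀ i, ContDiff ℝ (⊤ : ℕ∞) (p i)) (hw : ContDiff ℝ (⊤ : ℕ∞) w)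
    (k : Fin L) (t : ℝ) (α : Fin L → ℝ) : ∃ d, HasPder k (eqDet p w) d t α := by
  obtain ⟨n, hn⟩ := exists_hasPder_eqN hp k t α
  have hA := hasPder_eqA hp hw k t α
  have := (hn.mul (hasPder_eqB hp k t α)).add (hA.mul hA)
  exact ⟨_, by simpa only [HasPder, eqDet, sq] using this⟩

lemma exists_hasPder_raisedLast (hp : ∀ i, ContDiff ℝ (⊤ : ℕ∞) (p i))
    (hw : ContDiff ℝ (⊤ : ℕ∞) w) (k i : Fin L) (t : ℝ) (α : Fin L → ℝ) :
    ∃ d, HasPder k (raisedLast p w i) d t α := by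
  by_cases hi : i = 0
  · exact ⟨_, by simpa only [HasPder, raisedLast, hi, if_true] using hasPder_eqA hp hw k t α⟩
  · have := (hasPder_lastComp hp hw k i t α).mul (hasPder_eqB hp k t α)
    exact ⟨_, by simpa only [HasPder, raisedLast, lastComp, hi, if_false] using this⟩

lemma exists_hasPder_invNumer_zero (hp : ∀ i, ContDiff ℝ (⊤ : ℕ∞) (p i))
    (hw : ContDiff ℝ (⊤ : ℕ∞) w) (k j : Fin L) (t : ℝ) (α : Fin L → ℝ) :
    ∃ d, HasPder k (fun t α => invNumer p w t α 0 j) d t α := by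
  by_cases hj : j = 0
  · obtain ⟨n, hn⟩ := exists_hasPder_eqN hp k t α
    exact ⟨n, by simpa [HasPder, invNumer, hj] using hn⟩
  · have := (hasPder_price hp j k t α).mul (hasPder_eqA hp hw k t α)
    exact ⟨_, by simpa only [invNumer, Matrix.of_apply, hj, if_true, if_false] using this⟩

lemma exists_hasPder_eqC (hp : ∀ i, ContDiff ℝ (⊤ : ℕ∞) (p i)) (k : Fin L) (t : ℝ)
    (α : Fin L → ℝ) : ∃ d, HasPder k (fun t _ => eqC p t) d t α := by
  simp only [eqC]
  exact ⟨_, HasPder.sum fun m _ =>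
    (hasPder_of_hasDerivAt ((hp m).hasDerivAt_deriv_of_top t)).mul
      (hasPder_of_hasDerivAt ((contDiff_infty_iff_deriv.1 (hp m)).2.hasDerivAt_deriv_of_top t))⟩

/-- The Christoffel symbols are differentiable in every direction in which the second
derivatives of the last component are. -/
lemma exists_hasPder_christoffel (hp : ∀ i, ContDiff ℝ (⊤ : ℕ∞) (p i))
    (hw : ContDiff ℝ (⊤ : ℕ∞) w) (hD : ∀ t α, eqDet p w t α ≠ 0) {k i j : Fin L} {t d : ℝ}
    {α : Fin L → ℝ} (hH : HasPder k (lastHess p w i j) d t α) (s : Fin L) :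
    ∃ d, HasPder k (christoffel p w i j s) d t α := by
  obtain ⟨u, hu⟩ := exists_hasPder_raisedLast hp hw k s t α
  obtain ⟨m, hm⟩ := exists_hasPder_invNumer_zero hp hw k s t α
  obtain ⟨c, hc⟩ := exists_hasPder_eqC hp k t α
  obtain ⟨e, he⟩ := exists_hasPder_eqDet hp hw k t α
  have hF : christoffel p w i j s = fun t α => (lastHess p w i j t α * raisedLast p w s t α
      + (if i = 0 ∧ j = 0 then 1 else 0) * (eqC p t * invNumer p w t α 0 s))
        / eqDet p w t α := by
    funext t α
    rw [christoffel_eq hp hw i j s t α (hD t α)]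
    simp
  rw [hF]
  exact ⟨_, ((hH.mul hu).add ((hasPder_const _).mul (hc.mul hm))).div he (hD t α)⟩

lemma sum_raisedLast_mul_lastComp (p : Fin L → ℝ → ℝ) (w : ℝ → ℝ) (t : ℝ) (α : Fin L → ℝ) :
    ∑ s, raisedLast p w s t α * lastComp p w s t α = eqDet p w t α - eqB p t := by
  have : ∑ s ∈ Finset.univ \ {0}, raisedLast p w s t α * lastComp p w s t α
      = ∑ s ∈ Finset.univ \ {0}, eqB p t * (p s t * p s t) :=
    Finset.sum_congr rfl fun s hs => by
      have hs : s ≠ 0 := by simpa using hs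
      simp [raisedLast, lastComp, hs]
      ring
  rw [sum_eq_zero_add, this, ← Finset.mul_sum, sum_sq_eq]
  simp [raisedLast, lastComp, eqDet]
  ring

lemma sum_mul_sum_christoffel_mul_gMat (hp : ∀ i, ContDiff ℝ (⊤ : ℕ∞) (p i))
    (hw : ContDiff ℝ (⊤ : ℕ∞) w) (c : Fin L → ℝ) (j : Fin L) {i : Fin L} (hi : i ≠ 0) (t : ℝ)
    (α : Fin L → ℝ) (hD : eqDet p w t α ≠ 0) :
    ∑ s, (∑ m, c m * christoffel p w j m s t α) * gMat p w t α s i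
      = ∑ m, c m * (lastHess p w j m t α * lastComp p w i t α) := by
  simp only [Finset.sum_mul]
  rw [Finset.sum_comm]
  refine Finset.sum_congr rfl fun m _ => ?_
  simp only [mul_assoc, ← Finset.mul_sum]
  rw [sum_christoffel_mul_gMat hp hw j m i t α hD]
  simp [hi]

/-- Differentiating the first-kind symbols: the contraction of `∂_k Γ^s_{jl}` with `g_{si}`. -/
lemma sum_pder_christoffel_mul_gMat (hp : ∀ i, ContDiff ℝ (⊤ : ℕ∞) (p i))
    (hw : ContDiff ℝ (⊤ : ℕ∞) w) (hD : ∀ t α, eqDet p w t α ≠ 0) {k j l i : Fin L} (hi : i ≠ 0)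
    {t d : ℝ} {α : Fin L → ℝ} (hH : HasPder k (lastHess p w j l) d t α) :
    ∑ s, pder k (christoffel p w j l s) t α * gMat p w t α s i
      = d * lastComp p w i t α + lastHess p w j l t α * lastHess p w k i t α
        - ∑ s, christoffel p w j l s t α * (lastHess p w k s t α * lastComp p w i t α
          + lastComp p w s t α * lastHess p w k i t α) := by
  have h1 := HasPder.sum (u := Finset.univ) fun s _ =>
    (exists_hasPder_christoffel hp hw hD hH s).choose_spec.mul (hasPder_gMat hp hw k s i t α)
  have h2 := hH.mul (hasPder_lastComp hp hw k i t α)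
  have hF : (fun t α => ∑ s, christoffel p w j l s t α * gMat p w t α s i)
      = fun t α => lastHess p w j l t α * lastComp p w i t α := by
    funext t α
    rw [sum_christoffel_mul_gMat hp hw j l i t α (hD t α)]
    simp [hi]
  rw [hF] at h1
  have := h1.unique h2
  simp only [← (exists_hasPder_christoffel hp hw hD hH _).choose_spec.pder_eq, hi, and_false,
    if_false, zero_add, Finset.sum_add_distrib] at this
  rw [← this]
  simp only [Finset.sum_add_distrib, mul_add]
  ring

/-- The Gauss equation for the coordinate plane spanned by `X_0` and `X_i`. -/
lemma sum_curvR_mul_gMat (hp : ∀ i, ContDiff ℝ (⊤ : ℕ∞) (p i)) (hw : ContDiff ℝ (⊤ : ℕ∞) w)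
    (hD : ∀ t α, eqDet p w t α ≠ 0) {i : Fin L} (hi : i ≠ 0) (t : ℝ) (α : Fin L → ℝ) :
    ∑ s, curvR p w 0 i 0 s t α * gMat p w t α s i
      = -(deriv (p i) t ^ 2 * eqB p t / eqDet p w t α) := by
  have hΓ : ∑ s, christoffel p w i 0 s t α * lastComp p w s t α
      = -(deriv (p i) t) * ((eqDet p w t α - eqB p t) / eqDet p w t α) := by
    rw [← sum_raisedLast_mul_lastComp, Finset.sum_div, Finset.mul_sum]
    refine Finset.sum_congr rfl fun s _ => ?_
    rw [christoffel_eq hp hw i 0 s t α (hD t α)]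
    simp [hi, lastHess]
    ring
  have h0i : lastHess p w 0 i t α = -(deriv (p i) t) := by simp [lastHess, hi]
  have hi0 : lastHess p w i 0 t α = -(deriv (p i) t) := by simp [lastHess, hi]
  have hii : lastHess p w i i t α = 0 := by simp [lastHess, hi]
  simp only [curvR, sub_mul, add_mul, Finset.sum_sub_distrib, Finset.sum_add_distrib]
  rw [sum_mul_sum_christoffel_mul_gMat hp hw _ i hi t α (hD t α),
    sum_mul_sum_christoffel_mul_gMat hp hw _ 0 hi t α (hD t α),
    sum_pder_christoffel_mul_gMat hp hw hD hi (hasPder_lastHess_zero_zero hp hw hi t α),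
    sum_pder_christoffel_mul_gMat hp hw hD hi (hasPder_lastHess_right_zero hp hi t α)]
  simp only [mul_add, Finset.sum_add_distrib, h0i, hi0, hii, mul_zero, Finset.sum_const_zero,
    ← mul_assoc, ← Finset.sum_mul, hΓ]
  field_simp [hD t α]
  ring

end Calculus

theorem statement_16 (L : ℕ) [NeZero L] (hL : 2 ≤ L)
    (p : Fin L → ℝ → ℝ) (w : ℝ → ℝ)
    (hp : ∀ i, ContDiff ℝ (⊤ : ℕ∞) (p i)) (hw : ContDiff ℝ (⊤ : ℕ∞) w)
    (hreg : ∀ t : ℝ, 0 < eqB p t ∨ deriv w t ≠ 0) :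
    ∀ i : Fin L, i ≠ 0 →
      ∀ (t : ℝ) (α : Fin L → ℝ),
        0 < gMat p w t α 0 0 * gMat p w t α i i - (gMat p w t α 0 i) ^ 2
        ∧ (∑ s : Fin L, curvR p w 0 i 0 s t α * gMat p w t α s i)
            / (gMat p w t α 0 0 * gMat p w t α i i - (gMat p w t α 0 i) ^ 2) ≤ 0 := by
  intro i hi t α
  have hc : (0 : ℝ) < 1 + p i t ^ 2 := by positivity
  have hpos : 0 < gMat p w t α 0 0 * gMat p w t α i i - gMat p w t α 0 i ^ 2 := by
    refine (mul_eqB_add_sq_pos p w t α hc (hreg t)).trans_eq ?_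
    simp [gMat, hi]
    ring
  refine ⟨hpos, div_nonpos_of_nonpos_of_nonneg ?_ hpos.le⟩
  rw [sum_curvR_mul_gMat hp hw (fun t α => (eqDet_pos p w t α (hreg t)).ne') hi, neg_nonpos]
  exact div_nonneg (mul_nonneg (sq_nonneg _) (eqB_nonneg p t)) (eqDet_pos p w t α (hreg t)).le

end EqSelection
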